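/- Let m, n, h be natural numbers with n ≤ h. Let A be a real m × n matrix, b a real row vector of length n, H a real n × h matrix with rank H = n and H⁻ := Hᵀ (H Hᵀ)⁻¹, and suppose every entry of A · H is nonnegative. Then for every row vector x ∈ ℝ^m with all entries nonnegative, applying the entrywise ReLU (i.e., entrywise max with 0) to x · (A H) leaves it unchanged, and consequently (ReLU(x · (A H))) · H⁻ + b = x A + b. -/

import Mathlib

open Matrix

theorem Matrix.isUnit_of_rank_eq_card {ι K : Type*} [Fintype ι] [DecidableEq ι] [Field K]
    (M : Matrix ι ι K) (hM : M.rank = Fintype.card ι) : IsUnit M := by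
  rw [← Matrix.mulVec_surjective_iff_isUnit]
  have hrange : LinearMap.range M.mulVecLin = ⊤ :=
    Submodule.eq_top_of_finrank_eq (by rw [Module.finrank_fintype_fun_eq_card, ← hM, Matrix.rank])
  exact LinearMap.range_eq_top.mp hrange

theorem Matrix.mul_transpose_mul_inv_of_rank_eq {n h : ℕ} (H : Matrix (Fin n) (Fin h) ℝ)
    (hrank : H.rank = n) : H * (Hᵀ * (H * Hᵀ)⁻¹) = 1 := by
  have hunit : IsUnit (H * Hᵀ) := (H * Hᵀ).isUnit_of_rank_eq_card
    (by rw [Matrix.rank_self_mul_transpose, hrank, Fintype.card_fin])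
  rw [← Matrix.mul_assoc]
  exact Matrix.mul_nonsing_inv _ ((Matrix.isUnit_iff_isUnit_det _).mp hunit)

theorem stmt_4 (m n h : ℕ) (hnh : n ≤ h)
    (A : Matrix (Fin m) (Fin n) ℝ) (b : Fin n → ℝ)
    (H : Matrix (Fin n) (Fin h) ℝ) (hrank : H.rank = n)
    (hpos : ∀ i j, 0 ≤ (A * H) i j) :
    ∀ x : Fin m → ℝ, (∀ i, 0 ≤ x i) →
      (fun j => max ((x ᵥ* (A * H)) j) 0) = x ᵥ* (A * H) ∧
      ((fun j => max ((x ᵥ* (A * H)) j) 0) ᵥ* (Hᵀ * (H * Hᵀ)⁻¹)) + b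
        = (x ᵥ* A) + b := by
  intro x hx
  have hrelu : (fun j => max ((x ᵥ* (A * H)) j) 0) = x ᵥ* (A * H) :=
    funext fun j => max_eq_left <| by
      rw [Matrix.vecMul_eq_sum, Finset.sum_apply]
      exact Finset.sum_nonneg fun i _ => mul_nonneg (hx i) (hpos i j)
  refine ⟨hrelu, ?_⟩
  rw [hrelu, Matrix.vecMul_vecMul, Matrix.mul_assoc A, H.mul_transpose_mul_inv_of_rank_eq hrank,
    Matrix.mul_one]
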